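/- Let (Ω, 𝓕, μ) be a probability space and let η′ : Ω → [0, 1] be measurable. If (ηₙ)ₙ∈ℕ is a sequence of measurable functions Ω → [0, 1] such that lim_{n→∞} ∫_Ω ηₙ h dμ = 0 for every h ∈ L¹(μ), then lim_{n→∞} ∫_Ω (ηₙ ∨ η′) h dμ = ∫_Ω η′ h dμ for every h ∈ L¹(μ), where ηₙ ∨ η′ denotes the pointwise maximum. (That is, the map η ↦ η ∨ η′ on Δ = {f ∈ L^∞(μ) : 0 ≤ f ≤ 1} is sequentially continuous at 0 for the weak-* topology induced by the pairing with L¹(μ).) -/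

import Mathlib

open MeasureTheory Filter Topology

theorem stmt19
    {Ω : Type*} [MeasurableSpace Ω] (μ : Measure Ω) [IsProbabilityMeasure μ]
    (η' : Ω → ℝ) (hη'_meas : Measurable η') (hη'_mem : ∀ x, η' x ∈ Set.Icc (0:ℝ) 1)
    (ηs : ℕ → Ω → ℝ) (hηs_meas : ∀ n, Measurable (ηs n))
    (hηs_mem : ∀ n x, ηs n x ∈ Set.Icc (0:ℝ) 1)
    (hlim : ∀ h : Ω → ℝ, Integrable h μ →
      Tendsto (fun n => ∫ x, ηs n x * h x ∂μ) atTop (nhds 0)) :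
    ∀ h : Ω → ℝ, Integrable h μ →
      Tendsto (fun n => ∫ x, max (ηs n x) (η' x) * h x ∂μ) atTop
        (nhds (∫ x, η' x * h x ∂μ)) := by
  intro h hh
  have key : ∀ g : Ω → ℝ, Measurable g → (∀ x, g x ∈ Set.Icc (0:ℝ) 1) → ∀ k : Ω → ℝ,
      Integrable k μ → Integrable (fun x => g x * k x) μ := by
    intro g hg hg1 k hk
    refine hk.mono (hg.aestronglyMeasurable.mul hk.aestronglyMeasurable) ?_
    refine Filter.Eventually.of_forall fun x => ?_
    rw [norm_mul, Real.norm_of_nonneg (hg1 x).1]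
    exact mul_le_of_le_one_left (norm_nonneg _) (hg1 x).2
  have i2 := key η' hη'_meas hη'_mem h hh
  rw [tendsto_iff_norm_sub_tendsto_zero]
  refine squeeze_zero (fun n => norm_nonneg _) (fun n => ?_) (hlim (fun x => |h x|) hh.abs)
  have i1 := key (fun x => max (ηs n x) (η' x)) ((hηs_meas n).max hη'_meas)
    (fun x => ⟨le_max_of_le_left (hηs_mem n x).1, max_le (hηs_mem n x).2 (hη'_mem x).2⟩) h hh
  rw [← integral_sub i1 i2]
  refine norm_integral_le_of_norm_le (key _ (hηs_meas n) (hηs_mem n) _ hh.abs) ?_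
  refine Filter.Eventually.of_forall fun x => ?_
  rw [← sub_mul, norm_mul, Real.norm_eq_abs (h x)]
  refine mul_le_mul_of_nonneg_right ?_ (abs_nonneg _)
  have h1 := (hηs_mem n x).1
  have h2 := (hη'_mem x).1
  rw [Real.norm_of_nonneg (sub_nonneg.2 (le_max_right _ _)), sub_le_iff_le_add]
  exact max_le (by linarith) (by linarith)
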